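/- arXiv:1512.00183 — 2 statements merged into one kernel-verified Lean document; each statement's English description precedes it below -/
import Mathlib

section
/- Let z ∈ V ⊗ W_{p−1} satisfy b_{K,p−1}(z) = 0, where b_{K,p−1}: V ⊗ W_{p−1} → A_2 ⊗ W_{p−2} is the Koszul differential in weight 1. Then γ(z) := z + τ(z) + … + τ^{p−1}(z) belongs to W_p and b_{K,p}(γ(z)) = 0, where τ(v_1⊗…⊗v_p) = (−1)^{p−1} v_p ⊗ v_1 ⊗ … ⊗ v_{p−1}. -/
/- STATEMENT 14: Let `A = T(V)/(R)` be quadratic and write `p = q + 2`.  Let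
`z ∈ V ⊗ W_{p−1} ⊆ V^{⊗p}` satisfy `b_{K,p−1}(z) = 0`, where
`b_{K,p−1} = μ_{1,2} ∘ (1 + τ) : V ⊗ W_{p−1} → A_2 ⊗ V^{⊗(p−2)}` is the Koszul differential
in weight 1 (`μ_{1,2}` multiplies the first two letters into `A_2 = (V⊗V)/R`, and
`τ(v_1⊗…⊗v_p) = (−1)^{p−1} v_p⊗v_1⊗…⊗v_{p−1}`).  Then
`γ(z) = z + τ(z) + … + τ^{p−1}(z)` belongs to `W_p`, and `b_{K,p}(γ(z)) = 0`, where
`b_{K,p}` is the restriction of `1 − τ` to `W_p`. -/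

open TensorProduct PiTensorProduct

variable (k : Type*) [Field k] (V : Type*) [AddCommGroup V] [Module k V]

open TensorProduct PiTensorProduct

variable (k : Type*) [Field k] (V : Type*) [AddCommGroup V] [Module k V]

/-- The canonical equivalence `V^{⊗i} ⊗ V^{⊗j} ≃ V^{⊗(i+j)}`. -/
noncomputable def tpMul (i j : ℕ) : ((⨂[k]^i V) ⊗[k] (⨂[k]^j V)) ≃ₗ[k] ⨂[k]^(i + j) V :=
  (PiTensorProduct.tmulEquiv (ι := Fin i) (ι₂ := Fin j) k V).trans
    (PiTensorProduct.reindex k (fun _ => V) finSumFinEquiv)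

variable {k V}

/-- The subspace `S ⊗ T` of `V^{⊗(i+j)}` attached to subspaces `S ⊆ V^{⊗i}`, `T ⊆ V^{⊗j}`. -/
noncomputable def sprod {i j : ℕ} (S : Submodule k (⨂[k]^i V)) (T : Submodule k (⨂[k]^j V)) :
    Submodule k (⨂[k]^(i + j) V) :=
  Submodule.map (tpMul k V i j).toLinearMap (Submodule.map₂ (TensorProduct.mk k _ _) S T)

/-- Transport of subspaces of tensor powers along an equality of exponents. -/
noncomputable def scast {i j : ℕ} (h : i = j) (S : Submodule k (⨂[k]^i V)) :
    Submodule k (⨂[k]^j V) :=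
  Submodule.map (PiTensorProduct.reindex k (fun _ => V) (finCongr h)).toLinearMap S

/-- The identification `V^{⊗1} ≃ V`. -/
noncomputable def e1 : (⨂[k]^1 V) ≃ₗ[k] V := PiTensorProduct.subsingletonEquiv (0 : Fin 1)

/-- The identification `V^{⊗2} ≃ V ⊗ V`. -/
noncomputable def e2 : (⨂[k]^2 V) ≃ₗ[k] (V ⊗[k] V) :=
  (tpMul k V 1 1).symm.trans (TensorProduct.congr e1 e1)

/-- The Koszul subspaces `W p = ⋂_{i+2+j=p} V^{⊗i} ⊗ R ⊗ V^{⊗j}`; the intersection is empty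
for `p = 0, 1`, so `W 0` and `W 1` are the whole ambient spaces (`k` resp. `V`). -/
noncomputable def W (R : Submodule k (V ⊗[k] V)) (p : ℕ) : Submodule k (⨂[k]^p V) :=
  ⨅ (i : ℕ), ⨅ (j : ℕ), ⨅ (_ : i + 2 + j = p),
    scast (show i + (2 + j) = p by omega)
      (sprod (⊤ : Submodule k (⨂[k]^i V))
        (sprod (Submodule.map (e2 (k := k) (V := V)).symm.toLinearMap R)
          (⊤ : Submodule k (⨂[k]^j V))))


variable (k V)

/-- The signed cyclic permutation `τ(v_1⊗…⊗v_p) = (−1)^{p−1} v_p⊗v_1⊗…⊗v_{p−1}`. -/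
noncomputable def tauCyc (p : ℕ) : (⨂[k]^p V) →ₗ[k] ⨂[k]^p V :=
  ((-1 : k) ^ (p - 1)) • (PiTensorProduct.reindex k (fun _ : Fin p => V) (finRotate p)).toLinearMap

/-- The subspace `V ⊗ W_{q+1}` of `V^{⊗(q+2)}`. -/
noncomputable def VWsub (R : Submodule k (V ⊗[k] V)) (q : ℕ) : Submodule k (⨂[k]^(q+2) V) :=
  scast (show 1 + (q + 1) = q + 2 by omega)
    (sprod (⊤ : Submodule k (⨂[k]^1 V)) (W R (q + 1)))

/-- The map `μ_{1,2} : V^{⊗(q+2)} → A_2 ⊗ V^{⊗q}` multiplying the two first letters into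
`A_2 = (V⊗V)/R`. -/
noncomputable def mu12 (R : Submodule k (V ⊗[k] V)) (q : ℕ) :
    (⨂[k]^(q+2) V) →ₗ[k] (((V ⊗[k] V) ⧸ R) ⊗[k] ⨂[k]^q V) :=
  (TensorProduct.map (R.mkQ ∘ₗ (e2 (k := k) (V := V)).toLinearMap) LinearMap.id) ∘ₗ
    (tpMul k V 2 q).symm.toLinearMap ∘ₗ
    (PiTensorProduct.reindex k (fun _ => V) (finCongr (show q + 2 = 2 + q by omega))).toLinearMap

/-- `γ = 1 + τ + … + τ^{p−1}` on `V^{⊗p}`. -/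
noncomputable def gammaCyc (p : ℕ) : (⨂[k]^p V) →ₗ[k] ⨂[k]^p V :=
  ∑ i ∈ Finset.range p, (tauCyc k V p) ^ i

variable {k V}

/-! ### Helper lemmas -/

theorem aux_append_apply {i j : ℕ} (a : Fin i → V) (b : Fin j → V) (x : Fin (i + j)) :
    Fin.append a b x = if h : x.1 < i then a ⟨x.1, h⟩ else b ⟨x.1 - i, by omega⟩ := by
  refine Fin.addCases (fun y => ?_) (fun y => ?_) x
  · simp
  · simp

theorem aux_tpMul_tprod {i j : ℕ} (a : Fin i → V) (b : Fin j → V) :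
    tpMul k V i j (PiTensorProduct.tprod k a ⊗ₜ[k] PiTensorProduct.tprod k b)
      = PiTensorProduct.tprod k (Fin.append a b) := by
  unfold tpMul
  rw [LinearEquiv.trans_apply, PiTensorProduct.tmulEquiv_apply]
  erw [PiTensorProduct.reindex_tprod]
  congr 1
  funext x
  refine Fin.addCases (fun y => ?_) (fun y => ?_) x
  · simp
  · simp

theorem aux_reindex_tprod {m n : ℕ} (e : Fin m ≃ Fin n) (f : Fin m → V) (g : Fin n → V)
    (h : ∀ x, g (e x) = f x) :
    PiTensorProduct.reindex k (fun _ => V) e (PiTensorProduct.tprod k f)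
      = PiTensorProduct.tprod k g := by
  rw [PiTensorProduct.reindex_tprod]
  congr 1
  funext x
  rw [← h]; simp

theorem aux_rot_pow (n i : ℕ) (x : Fin (n + 1)) :
    (((finRotate (n + 1)) ^ i) x).1 = (x.1 + i) % (n + 1) := by
  induction i with
  | zero => simp [Nat.mod_eq_of_lt x.2]
  | succ i ih =>
    rw [pow_succ', Equiv.Perm.mul_apply, finRotate_apply, Fin.val_add, ih]
    simp [add_assoc]

theorem aux_reindex_pow (p i : ℕ) :
    ((PiTensorProduct.reindex k (fun _ : Fin p => V) (finRotate p)).toLinearMap) ^ i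
      = (PiTensorProduct.reindex k (fun _ : Fin p => V) ((finRotate p) ^ i)).toLinearMap := by
  induction i with
  | zero =>
    ext f
    simp only [pow_zero, LinearMap.compMultilinearMap_apply, LinearEquiv.coe_coe]
    exact (aux_reindex_tprod _ f f (fun x => rfl)).symm
  | succ i ih =>
    rw [pow_succ', ih]
    ext f
    simp only [Module.End.mul_apply, LinearMap.compMultilinearMap_apply, LinearEquiv.coe_coe]
    rw [aux_reindex_tprod ((finRotate p) ^ i) f (fun x => f (((finRotate p) ^ i).symm x))
        (fun x => by rw [Equiv.symm_apply_apply]),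
      aux_reindex_tprod ((finRotate p) ^ (i + 1)) f
        (fun x => f (((finRotate p) ^ (i + 1)).symm x))
        (fun x => by rw [Equiv.symm_apply_apply])]
    refine aux_reindex_tprod _ _ _ (fun x => congrArg f ?_)
    rw [Equiv.symm_apply_eq, pow_succ', Equiv.Perm.mul_apply, Equiv.apply_symm_apply]

theorem aux_tau_pow (p i : ℕ) :
    (tauCyc k V p) ^ i = (((-1 : k) ^ (p - 1)) ^ i) •
      (PiTensorProduct.reindex k (fun _ : Fin p => V) ((finRotate p) ^ i)).toLinearMap := by
  rw [tauCyc, smul_pow, aux_reindex_pow]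

theorem aux_tau_pow_self (q : ℕ) : (tauCyc k V (q + 2)) ^ (q + 2) = 1 := by
  rw [aux_tau_pow]
  have h1 : (((-1 : k) ^ (q + 2 - 1)) ^ (q + 2)) = 1 := by
    rw [← pow_mul]
    apply Even.neg_one_pow
    have : q + 2 - 1 = q + 1 := by omega
    rw [this]
    exact Nat.even_mul_succ_self (q + 1)
  have h2 : (finRotate (q + 2)) ^ (q + 2) = 1 := by
    ext x
    rw [aux_rot_pow (q + 1)]
    simp [Nat.mod_eq_of_lt x.2]
  rw [h1, h2, one_smul]
  ext f
  simp only [LinearMap.compMultilinearMap_apply, LinearEquiv.coe_coe]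
  exact aux_reindex_tprod _ f f (fun x => rfl)

/-- The subspace `V^{⊗i} ⊗ R ⊗ V^{⊗j}` of `V^{⊗p}`. -/
noncomputable def auxR (R : Submodule k (V ⊗[k] V)) (p i j : ℕ) (h : i + 2 + j = p) :
    Submodule k (⨂[k]^p V) :=
  scast (show i + (2 + j) = p by omega)
      (sprod (⊤ : Submodule k (⨂[k]^i V))
        (sprod (Submodule.map (e2 (k := k) (V := V)).symm.toLinearMap R)
          (⊤ : Submodule k (⨂[k]^j V))))

/-- The subspace `R ⊗ V^{⊗q}`. -/
noncomputable def auxR0 (R : Submodule k (V ⊗[k] V)) (q : ℕ) :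
    Submodule k (⨂[k]^(q + 2) V) :=
  scast (show 2 + q = q + 2 by omega)
        (sprod (Submodule.map (e2 (k := k) (V := V)).symm.toLinearMap R)
          (⊤ : Submodule k (⨂[k]^q V)))

theorem aux_sprod_span {i j : ℕ} (s : Set (⨂[k]^i V)) (t : Set (⨂[k]^j V)) :
    sprod (Submodule.span k s) (Submodule.span k t) =
      Submodule.span k (Set.image2 (fun a b => tpMul k V i j (a ⊗ₜ[k] b)) s t) := by
  unfold sprod
  rw [Submodule.map₂_span_span, Submodule.map_span, Set.image_image2]
  rfl

theorem aux_scast_span {i j : ℕ} (h : i = j) (s : Set (⨂[k]^i V)) :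
    scast h (Submodule.span k s) =
      Submodule.span k ((PiTensorProduct.reindex k (fun _ => V) (finCongr h)) '' s) := by
  unfold scast
  rw [Submodule.map_span]
  rfl

theorem aux_top (i : ℕ) : (⊤ : Submodule k (⨂[k]^i V)) =
    Submodule.span k (Set.range (PiTensorProduct.tprod k)) :=
  PiTensorProduct.span_tprod_eq_top.symm

/-- `R` inside `V^{⊗2}`. -/
noncomputable def auxRR (R : Submodule k (V ⊗[k] V)) : Submodule k (⨂[k]^2 V) :=
  Submodule.map (e2 (k := k) (V := V)).symm.toLinearMap R

theorem auxR_span (R : Submodule k (V ⊗[k] V)) (p i j : ℕ) (h : i + 2 + j = p) :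
    auxR R p i j h = Submodule.span k {x | ∃ (a : Fin i → V) (r : ⨂[k]^2 V) (b : Fin j → V),
      r ∈ auxRR R ∧ PiTensorProduct.reindex k (fun _ => V)
        (finCongr (show i + (2 + j) = p by omega))
        (tpMul k V i (2 + j) (PiTensorProduct.tprod k a ⊗ₜ[k]
          tpMul k V 2 j (r ⊗ₜ[k] PiTensorProduct.tprod k b))) = x} := by
  unfold auxR
  rw [aux_top i, aux_top j,
    ← Submodule.span_eq (Submodule.map (e2 (k := k) (V := V)).symm.toLinearMap R),
    aux_sprod_span, aux_sprod_span, aux_scast_span]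
  congr 1
  ext x
  constructor
  · rintro ⟨_, ⟨_, ⟨a, rfl⟩, _, ⟨r, hr, _, ⟨b, rfl⟩, rfl⟩, rfl⟩, rfl⟩
    exact ⟨a, r, b, hr, rfl⟩
  · rintro ⟨a, r, b, hr, rfl⟩
    exact ⟨_, ⟨_, ⟨a, rfl⟩, _, ⟨r, hr, _, ⟨b, rfl⟩, rfl⟩, rfl⟩, rfl⟩

theorem auxR0_span (R : Submodule k (V ⊗[k] V)) (q : ℕ) :
    auxR0 R q = Submodule.span k {x | ∃ (r : ⨂[k]^2 V) (b : Fin q → V),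
      r ∈ auxRR R ∧ PiTensorProduct.reindex k (fun _ => V)
        (finCongr (show 2 + q = q + 2 by omega))
          (tpMul k V 2 q (r ⊗ₜ[k] PiTensorProduct.tprod k b)) = x} := by
  unfold auxR0
  rw [aux_top q,
    ← Submodule.span_eq (Submodule.map (e2 (k := k) (V := V)).symm.toLinearMap R),
    aux_sprod_span, aux_scast_span]
  congr 1
  ext x
  constructor
  · rintro ⟨_, ⟨r, hr, _, ⟨b, rfl⟩, rfl⟩, rfl⟩
    exact ⟨r, b, hr, rfl⟩
  · rintro ⟨r, b, hr, rfl⟩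
    exact ⟨_, ⟨r, hr, _, ⟨b, rfl⟩, rfl⟩, rfl⟩

theorem aux_rot_key (q i j : ℕ) (h : i + 2 + j = q + 2) (a : Fin i → V) (b : Fin j → V)
    (c : Fin q → V)
    (hc : ∀ x : Fin q, c x = if hx : x.1 < j then b ⟨x.1, hx⟩ else a ⟨x.1 - j, by omega⟩)
    (r : ⨂[k]^2 V) :
    PiTensorProduct.reindex k (fun _ : Fin (q + 2) => V) ((finRotate (q + 2)) ^ i)
      (PiTensorProduct.reindex k (fun _ => V) (finCongr (show 2 + q = q + 2 by omega))
          (tpMul k V 2 q (r ⊗ₜ[k] PiTensorProduct.tprod k c))) =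
    PiTensorProduct.reindex k (fun _ => V)
        (finCongr (show i + (2 + j) = q + 2 by omega))
        (tpMul k V i (2 + j) (PiTensorProduct.tprod k a ⊗ₜ[k]
          tpMul k V 2 j (r ⊗ₜ[k] PiTensorProduct.tprod k b))) := by
  have hr : r ∈ Submodule.span k (Set.range (PiTensorProduct.tprod k (s := fun _ : Fin 2 => V))) :=
    by rw [PiTensorProduct.span_tprod_eq_top]; trivial
  induction hr using Submodule.span_induction with
  | zero => simp
  | add x y _ _ hx hy =>
    simp only [TensorProduct.add_tmul, TensorProduct.tmul_add, map_add, hx, hy]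
  | smul t x _ hx =>
    simp only [← TensorProduct.smul_tmul', map_smul, TensorProduct.tmul_smul, hx]
  | mem x hx =>
    obtain ⟨f, rfl⟩ := hx
    rw [aux_tpMul_tprod, aux_tpMul_tprod, aux_tpMul_tprod]
    rw [aux_reindex_tprod (finCongr (show i + (2 + j) = q + 2 by omega)) _
      (fun x => Fin.append a (Fin.append f b) (Fin.cast (by omega) x)) (fun x => by simp)]
    rw [aux_reindex_tprod (finCongr (show 2 + q = q + 2 by omega)) _
      (fun x => Fin.append f c (Fin.cast (by omega) x)) (fun x => by simp)]
    apply aux_reindex_tprod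
    intro x
    have hx := aux_rot_pow (q + 1) i x
    generalize ((finRotate (q + 2)) ^ i) x = y at hx ⊢
    have hx2 := x.2
    simp only [aux_append_apply, hc, Fin.val_cast]
    by_cases hlt : x.1 + i < q + 2
    · rw [Nat.mod_eq_of_lt hlt] at hx
      rw [dif_neg (by omega)]
      by_cases h2 : x.1 < 2
      · rw [dif_pos (by omega), dif_pos (by omega)]
        congr 2; omega
      · rw [dif_neg (by omega), dif_neg (by omega), dif_pos (by omega)]
        congr 2; omega
    · have : (x.1 + i) % (q + 1 + 1) = x.1 + i - (q + 2) := by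
        rw [Nat.mod_eq_sub_mod (by omega), Nat.mod_eq_of_lt (by omega)]
      rw [this] at hx
      rw [dif_pos (by omega), dif_neg (by omega), dif_neg (by omega)]
      congr 2; omega

theorem auxR_eq (R : Submodule k (V ⊗[k] V)) (q i j : ℕ) (h : i + 2 + j = q + 2) :
    auxR R (q + 2) i j h = Submodule.map ((tauCyc k V (q + 2)) ^ i) (auxR0 R q) := by
  rw [aux_tau_pow, Submodule.map_smul _ _ _ (by simp), auxR_span, auxR0_span, Submodule.map_span]
  congr 1
  ext x
  constructor
  · rintro ⟨a, r, b, hr, rfl⟩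
    refine ⟨_, ⟨r, fun x => if hx : x.1 < j then b ⟨x.1, hx⟩ else a ⟨x.1 - j, by omega⟩, hr, rfl⟩, ?_⟩
    exact aux_rot_key q i j h a b _ (fun _ => rfl) r
  · rintro ⟨_, ⟨r, c, hr, rfl⟩, rfl⟩
    refine ⟨fun x => c ⟨x.1 + j, by omega⟩, r, fun x => c ⟨x.1, by omega⟩, hr, ?_⟩
    refine (aux_rot_key q i j h _ _ c (fun x => ?_) r).symm
    split_ifs with hx
    · rfl
    · exact congrArg c (Fin.ext (by simp only []; omega))

theorem aux_assoc_key (q i j : ℕ) (h : i + 2 + j = q + 1) (v : Fin 1 → V) (a : Fin i → V)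
    (b : Fin j → V) (r : ⨂[k]^2 V) :
    PiTensorProduct.reindex k (fun _ => V) (finCongr (show 1 + (q + 1) = q + 2 by omega))
      (tpMul k V 1 (q + 1) (PiTensorProduct.tprod k v ⊗ₜ[k]
        PiTensorProduct.reindex k (fun _ => V)
        (finCongr (show i + (2 + j) = q + 1 by omega))
        (tpMul k V i (2 + j) (PiTensorProduct.tprod k a ⊗ₜ[k]
          tpMul k V 2 j (r ⊗ₜ[k] PiTensorProduct.tprod k b))))) =
    PiTensorProduct.reindex k (fun _ => V)
        (finCongr (show (1 + i) + (2 + j) = q + 2 by omega))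
        (tpMul k V (1 + i) (2 + j) (PiTensorProduct.tprod k (Fin.append v a) ⊗ₜ[k]
          tpMul k V 2 j (r ⊗ₜ[k] PiTensorProduct.tprod k b))) := by
  have hr : r ∈ Submodule.span k (Set.range (PiTensorProduct.tprod k (s := fun _ : Fin 2 => V))) :=
    by rw [PiTensorProduct.span_tprod_eq_top]; trivial
  induction hr using Submodule.span_induction with
  | zero => simp
  | add x y _ _ hx hy =>
    simp only [TensorProduct.add_tmul, TensorProduct.tmul_add, map_add, hx, hy]
  | smul t x _ hx =>
    simp only [← TensorProduct.smul_tmul', map_smul, TensorProduct.tmul_smul, hx]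
  | mem x hx =>
    obtain ⟨f, rfl⟩ := hx
    rw [aux_tpMul_tprod, aux_tpMul_tprod, aux_tpMul_tprod]
    rw [aux_reindex_tprod (finCongr (show i + (2 + j) = q + 1 by omega)) _
      (fun x => Fin.append a (Fin.append f b) (Fin.cast (by omega) x)) (fun x => by simp)]
    rw [aux_tpMul_tprod]
    rw [aux_reindex_tprod (finCongr (show (1 + i) + (2 + j) = q + 2 by omega)) _
      (fun x => Fin.append (Fin.append v a) (Fin.append f b) (Fin.cast (by omega) x))
      (fun x => by simp)]
    apply aux_reindex_tprod
    intro x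
    have hx2 := x.2
    simp only [aux_append_apply, Fin.val_cast, finCongr_apply]
    by_cases h1 : x.1 < 1
    · rw [dif_pos (by omega), dif_pos (by omega), dif_pos (by omega)]
    · rw [dif_neg (c := x.1 < 1) (by omega)]
      by_cases h2 : x.1 < 1 + i
      · rw [dif_pos (by omega), dif_neg (by omega), dif_pos (by omega)]
      · rw [dif_neg (c := x.1 < 1 + i) (by omega), dif_neg (c := x.1 - 1 < i) (by omega)]
        by_cases h3 : x.1 < 1 + i + 2
        · rw [dif_pos (c := x.1 - (1 + i) < 2) (by omega),
            dif_pos (c := x.1 - 1 - i < 2) (by omega)]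
          congr 2; omega
        · rw [dif_neg (c := x.1 - (1 + i) < 2) (by omega),
            dif_neg (c := x.1 - 1 - i < 2) (by omega)]
          congr 2; omega

theorem aux_VW_le (R : Submodule k (V ⊗[k] V)) (q i j : ℕ) (h : i + 2 + j = q + 1) :
    VWsub k V R q ≤ auxR R (q + 2) (1 + i) j (by omega) := by
  have hW : W R (q + 1) ≤ auxR R (q + 1) i j h :=
    iInf_le_of_le i (iInf_le_of_le j (iInf_le_of_le h le_rfl))
  have h1 : VWsub k V R q ≤ scast (show 1 + (q + 1) = q + 2 by omega)
      (sprod (⊤ : Submodule k (⨂[k]^1 V)) (auxR R (q + 1) i j h)) :=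
    Submodule.map_mono (Submodule.map_mono (Submodule.map₂_le_map₂_right hW))
  refine h1.trans ?_
  rw [auxR_span, auxR_span, aux_top 1, aux_sprod_span, aux_scast_span, Submodule.span_le]
  rintro _ ⟨_, ⟨_, ⟨v, rfl⟩, _, ⟨a, r, b, hr, rfl⟩, rfl⟩, rfl⟩
  refine Submodule.subset_span ⟨Fin.append v a, r, b, hr, ?_⟩
  exact (aux_assoc_key q i j h v a b r).symm

theorem aux_ker (R : Submodule k (V ⊗[k] V)) (q : ℕ) (x : ⨂[k]^(q + 2) V)
    (hx : mu12 k V R q x = 0) : x ∈ auxR0 R q := by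
  have hex : Function.Exact (auxRR R).subtype
      (R.mkQ ∘ₗ (e2 (k := k) (V := V)).toLinearMap) := by
    intro y
    simp only [LinearMap.comp_apply, LinearEquiv.coe_coe, Submodule.mkQ_apply,
      Submodule.Quotient.mk_eq_zero, Submodule.coe_subtype, Subtype.range_coe_subtype]
    show _ ↔ y ∈ auxRR R
    unfold auxRR
    constructor
    · intro hy
      exact ⟨_, hy, by simp⟩
    · rintro ⟨w, hw, rfl⟩
      simpa using hw
  have hsurj : Function.Surjective (R.mkQ ∘ₗ (e2 (k := k) (V := V)).toLinearMap) := by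
    rw [LinearMap.coe_comp]
    exact (Submodule.mkQ_surjective R).comp e2.surjective
  have := rTensor_exact (⨂[k]^q V) hex hsurj
  obtain ⟨w, hw⟩ := (this _).1 hx
  have hxe : x = PiTensorProduct.reindex k (fun _ => V) (finCongr (show 2 + q = q + 2 by omega))
      (tpMul k V 2 q (LinearMap.rTensor (⨂[k]^q V) (auxRR R).subtype w)) := by
    rw [hw]
    simp only [LinearMap.comp_apply, LinearEquiv.coe_coe, LinearEquiv.apply_symm_apply]
    rw [← LinearEquiv.symm_apply_eq, PiTensorProduct.reindex_symm]
    rfl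
  rw [hxe]
  refine ⟨_, ⟨_, ?_, rfl⟩, rfl⟩
  clear hw hxe hx
  induction w with
  | zero => simp
  | add a b ha hb => rw [map_add]; exact add_mem ha hb
  | tmul a b => exact Submodule.apply_mem_map₂ _ a.2 trivial

theorem gamma_of_weight_one_cycle_mem_W (R : Submodule k (V ⊗[k] V)) (q : ℕ) :
    ∀ z ∈ VWsub k V R q,
      (mu12 k V R q) (z + tauCyc k V (q + 2) z) = 0 →
        gammaCyc k V (q + 2) z ∈ W R (q + 2) ∧
        ((LinearMap.id : (⨂[k]^(q+2) V) →ₗ[k] ⨂[k]^(q+2) V) - tauCyc k V (q + 2))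
            (gammaCyc k V (q + 2) z) = 0 := by
  intro z hz hb
  set τ := tauCyc k V (q + 2) with hτ
  have hp : τ ^ (q + 2) = 1 := aux_tau_pow_self q
  have h0 : z + τ z ∈ auxR0 R q := aux_ker R q _ hb
  have hzi : ∀ i, 1 ≤ i → i ≤ q → z ∈ Submodule.map (τ ^ i) (auxR0 R q) := by
    intro i h1 h2
    obtain ⟨i, rfl⟩ : ∃ m, i = 1 + m := ⟨i - 1, by omega⟩
    have := aux_VW_le R q i (q - 1 - i) (by omega) hz
    rwa [auxR_eq] at this
  have hshift : ∀ (x : ⨂[k]^(q + 2) V) (i j : ℕ), x ∈ Submodule.map (τ ^ i) (auxR0 R q) →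
      (τ ^ j) x ∈ Submodule.map (τ ^ (j + i)) (auxR0 R q) := by
    rintro _ i j ⟨y, hy, rfl⟩
    exact ⟨y, hy, by rw [pow_add]; rfl⟩
  constructor
  · unfold W
    simp only [Submodule.mem_iInf]
    intro i j hij
    change gammaCyc k V (q + 2) z ∈ auxR R (q + 2) i j hij
    rw [auxR_eq R q i j hij, ← hτ]
    have hsum : gammaCyc k V (q + 2) z = ∑ s ∈ Finset.range (q + 2), (τ ^ s) z := by
      simp [gammaCyc, hτ]
    have hsub : ({i, i + 1} : Finset ℕ) ⊆ Finset.range (q + 2) := by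
      intro s hs
      simp only [Finset.mem_insert, Finset.mem_singleton] at hs
      rw [Finset.mem_range]; omega
    rw [hsum, ← Finset.sum_sdiff hsub]
    refine add_mem (Submodule.sum_mem _ fun s hs => ?_) ?_
    · simp only [Finset.mem_sdiff, Finset.mem_range, Finset.mem_insert,
        Finset.mem_singleton, not_or] at hs
      by_cases hlt : s < i
      · have := hshift z (i - s) s (hzi _ (by omega) (by omega))
        rwa [show s + (i - s) = i by omega] at this
      · have := hshift z (q + 2 + i - s) s (hzi _ (by omega) (by omega))
        rwa [show s + (q + 2 + i - s) = (q + 2) + i by omega, pow_add, hp, one_mul] at this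
    · rw [Finset.sum_pair (by omega)]
      refine ⟨z + τ z, h0, ?_⟩
      rw [map_add, pow_succ]; rfl
  · have h : (1 - τ) * gammaCyc k V (q + 2) = 0 := by
      unfold gammaCyc
      rw [← hτ, mul_neg_geom_sum, hp, sub_self]
    exact LinearMap.congr_fun h z
end

section
/- Let A = k⟨x,y⟩/(x², y² − xy) with char(k) = 0. Then for every p ≥ 3, the Koszul space W_p equals k·x^{⊗p}. -/
/- STATEMENT 18: Let `char k = 0`, `V = k·x ⊕ k·y` and
`R = span{x⊗x, y⊗y − x⊗y} ⊆ V ⊗ V`, so that `A = T(V)/(R) = k⟨x,y⟩/(x², y² − xy)`.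
Then for every `p ≥ 3` the Koszul subspace `W_p ⊆ V^{⊗p}` equals `k·x^{⊗p}`. -/

open TensorProduct PiTensorProduct

variable (k : Type*) [Field k] (V : Type*) [AddCommGroup V] [Module k V]

open TensorProduct PiTensorProduct

variable (k : Type*) [Field k] (V : Type*) [AddCommGroup V] [Module k V]

variable {k V}

section Example

variable (k : Type*) [Field k] [CharZero k]

local notation "V2" => (Fin 2 → k)

/-- The generator `x`. -/
noncomputable def xg : V2 := Pi.single 0 1

/-- The generator `y`. -/
noncomputable def yg : V2 := Pi.single 1 1

/-- The space of relations `R = span{x⊗x, y⊗y − x⊗y}` of `A = k⟨x,y⟩/(x², y² − xy)`. -/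
noncomputable def Rex : Submodule k (V2 ⊗[k] V2) :=
  Submodule.span k {xg k ⊗ₜ[k] xg k, yg k ⊗ₜ[k] yg k - xg k ⊗ₜ[k] yg k}

end Example

section Helpers

variable {k : Type*} [Field k]

/-- coordinate functional of a word -/
noncomputable def phi {n : ℕ} (w : Fin n → Fin 2) : (⨂[k]^n (Fin 2 → k)) →ₗ[k] k :=
  PiTensorProduct.lift ((MultilinearMap.mkPiAlgebra k (Fin n) k).compLinearMap
    (fun i => (LinearMap.proj (w i) : (Fin 2 → k) →ₗ[k] k)))

theorem phi_tprod {n : ℕ} (w : Fin n → Fin 2) (v : Fin n → (Fin 2 → k)) :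
    phi w (PiTensorProduct.tprod k v) = ∏ i, v i (w i) := by
  simp [phi]

theorem tpMul_tprod {V : Type*} [AddCommGroup V] [Module k V] {i j : ℕ}
    (a : Fin i → V) (b : Fin j → V) :
    tpMul k V i j (PiTensorProduct.tprod k a ⊗ₜ PiTensorProduct.tprod k b) =
      PiTensorProduct.tprod k (Fin.append a b) := by
  unfold tpMul
  rw [LinearEquiv.trans_apply, PiTensorProduct.tmulEquiv_apply]
  erw [PiTensorProduct.reindex_tprod]
  congr 1
  funext s
  refine Fin.addCases (fun s => ?_) (fun s => ?_) s <;> simp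

theorem phi_tpMul {i j : ℕ} (w : Fin (i + j) → Fin 2)
    (u : ⨂[k]^i (Fin 2 → k)) (v : ⨂[k]^j (Fin 2 → k)) :
    phi w (tpMul k (Fin 2 → k) i j (u ⊗ₜ v)) =
      phi (fun a => w (Fin.castAdd j a)) u * phi (fun a => w (Fin.natAdd i a)) v := by
  induction u using PiTensorProduct.induction_on with
  | smul_tprod r a =>
    induction v using PiTensorProduct.induction_on with
    | smul_tprod s b =>
      simp only [← TensorProduct.smul_tmul', TensorProduct.tmul_smul, map_smul, tpMul_tprod,
        phi_tprod, Fin.prod_univ_add, Fin.append_left, Fin.append_right, smul_eq_mul]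
      ring
    | add x y hx hy => simp only [TensorProduct.tmul_add, map_add, hx, hy, mul_add]
  | add x y hx hy => simp only [TensorProduct.add_tmul, map_add, hx, hy, add_mul]

theorem phi_cast {m n : ℕ} (h : m = n) (w : Fin n → Fin 2) (t : ⨂[k]^m (Fin 2 → k)) :
    phi w (PiTensorProduct.reindex k (fun _ => (Fin 2 → k)) (finCongr h) t) =
      phi (fun a => w (Fin.cast h a)) t := by
  subst h
  simp

theorem e2_symm_tmul {V : Type*} [AddCommGroup V] [Module k V] (a b : V) :
    (e2 (k := k) (V := V)).symm (a ⊗ₜ b) = PiTensorProduct.tprod k ![a, b] := by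
  rw [LinearEquiv.symm_apply_eq]
  have : (PiTensorProduct.tprod k ![a, b] : ⨂[k]^2 V) = tpMul k V 1 1
      (PiTensorProduct.tprod k (fun _ => a) ⊗ₜ PiTensorProduct.tprod k (fun _ => b)) := by
    rw [tpMul_tprod]
    congr 1
    funext s
    fin_cases s <;> rfl
  rw [this]
  simp [e2, e1]

theorem phi_R (w : Fin 2 → Fin 2) (h0 : w 0 = 1) (h1 : w 1 = 0)
    (r : (Fin 2 → k) ⊗[k] (Fin 2 → k)) (hr : r ∈ Rex k) :
    phi w ((e2 (k := k) (V := Fin 2 → k)).symm r) = 0 := by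
  unfold Rex at hr
  induction hr using Submodule.span_induction with
  | mem x h =>
    rcases h with rfl | rfl <;>
    simp [e2_symm_tmul, phi_tprod, h0, h1, xg, yg, Fin.prod_univ_two]
  | zero => simp
  | add x y _ _ hx hy => simp [hx, hy]
  | smul c x _ hx => simp [hx]

theorem phi_R2 (w w' : Fin 2 → Fin 2) (h0 : w 0 = 0) (h1 : w 1 = 1) (h0' : w' 0 = 1)
    (h1' : w' 1 = 1) (r : (Fin 2 → k) ⊗[k] (Fin 2 → k)) (hr : r ∈ Rex k) :
    phi w ((e2 (k := k) (V := Fin 2 → k)).symm r)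
      + phi w' ((e2 (k := k) (V := Fin 2 → k)).symm r) = 0 := by
  unfold Rex at hr
  induction hr using Submodule.span_induction with
  | mem x h =>
    rcases h with rfl | rfl <;>
    simp [e2_symm_tmul, phi_tprod, h0, h1, h0', h1', xg, yg, Fin.prod_univ_two]
  | zero => simp
  | add x y _ _ hx hy =>
    simp only [map_add]
    linear_combination hx + hy
  | smul c x _ hx =>
    simp only [map_smul, smul_eq_mul]
    linear_combination c * hx

theorem space_le_ker {p i j : ℕ} (h : i + (2 + j) = p)
    (R : Submodule k ((Fin 2 → k) ⊗[k] (Fin 2 → k)))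
    (L : (⨂[k]^p (Fin 2 → k)) →ₗ[k] k)
    (hL : ∀ u, ∀ r ∈ R, ∀ v, L (PiTensorProduct.reindex k (fun _ => (Fin 2 → k)) (finCongr h)
      (tpMul k _ i (2 + j) (u ⊗ₜ tpMul k _ 2 j (e2.symm r ⊗ₜ v)))) = 0) :
    scast h (sprod (⊤ : Submodule k (⨂[k]^i (Fin 2 → k)))
        (sprod (Submodule.map (e2 (k := k) (V := Fin 2 → k)).symm.toLinearMap R)
          (⊤ : Submodule k (⨂[k]^j (Fin 2 → k))))) ≤ LinearMap.ker L := by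
  unfold scast sprod
  rw [Submodule.map_le_iff_le_comap, Submodule.map_le_iff_le_comap, Submodule.map₂_le]
  intro u _ t ht
  obtain ⟨s, hs, rfl⟩ := ht
  let M : ((⨂[k]^2 (Fin 2 → k)) ⊗[k] (⨂[k]^j (Fin 2 → k))) →ₗ[k] k :=
    L ∘ₗ (PiTensorProduct.reindex k (fun _ => (Fin 2 → k)) (finCongr h)).toLinearMap ∘ₗ
      (tpMul k (Fin 2 → k) i (2 + j)).toLinearMap ∘ₗ (TensorProduct.mk k _ _ u) ∘ₗ
      (tpMul k (Fin 2 → k) 2 j).toLinearMap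
  have hM : Submodule.map₂ (TensorProduct.mk k _ _)
      (Submodule.map (e2 (k := k) (V := Fin 2 → k)).symm.toLinearMap R)
      (⊤ : Submodule k (⨂[k]^j (Fin 2 → k))) ≤ LinearMap.ker M := by
    rw [Submodule.map₂_le]
    rintro m ⟨r, hr, rfl⟩ v _
    exact hL u r hr v
  exact hM hs

theorem phi_descent {p : ℕ} (t : ⨂[k]^p (Fin 2 → k)) (ht : t ∈ W (Rex k) p)
    (w : Fin p → Fin 2) (i : ℕ) (hi : i + 1 < p) (h0 : w ⟨i, by omega⟩ = 1)
    (h1 : w ⟨i + 1, hi⟩ = 0) : phi w t = 0 := by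
  simp only [W, Submodule.mem_iInf] at ht
  have := ht i (p - 2 - i) (by omega)
  refine space_le_ker _ _ (phi w) ?_ this
  intro u r hr v
  rw [phi_cast, phi_tpMul, phi_tpMul, phi_R _ _ _ r hr]
  · simp
  · rw [← h0]; rfl
  · rw [← h1]; rfl

theorem phi_ascent {p : ℕ} (t : ⨂[k]^p (Fin 2 → k)) (ht : t ∈ W (Rex k) p)
    (w : Fin p → Fin 2) (i : ℕ) (hi : i + 1 < p) (h0 : w ⟨i, by omega⟩ = 0)
    (h1 : w ⟨i + 1, hi⟩ = 1) :
    phi w t + phi (Function.update w ⟨i, by omega⟩ 1) t = 0 := by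
  simp only [W, Submodule.mem_iInf] at ht
  have := ht i (p - 2 - i) (by omega)
  refine space_le_ker _ _ (phi w + phi (Function.update w ⟨i, by omega⟩ 1)) ?_ this
  intro u r hr v
  rw [LinearMap.add_apply, phi_cast, phi_tpMul, phi_tpMul, phi_cast, phi_tpMul, phi_tpMul]
  have key := phi_R2 (k := k) (fun a : Fin 2 => w ⟨i + a, by omega⟩)
    (fun a : Fin 2 => Function.update w ⟨i, by omega⟩ 1 ⟨i + a, by omega⟩)
    h0 h1 (by simp) (by simp [Function.update_apply, h1]) r hr
  have ea : (fun a : Fin i => Function.update w ⟨i, by omega⟩ 1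
      (Fin.cast (show i + (2 + (p - 2 - i)) = p by omega) (Fin.castAdd _ a))) =
      fun a : Fin i => w (Fin.cast (show i + (2 + (p - 2 - i)) = p by omega)
        (Fin.castAdd _ a)) := by
    funext a
    rw [Function.update_of_ne]
    intro h
    have := congrArg Fin.val h
    simp at this
    omega
  have eb : (fun a : Fin (p - 2 - i) => Function.update w ⟨i, by omega⟩ 1
      (Fin.cast (show i + (2 + (p - 2 - i)) = p by omega) (Fin.natAdd i (Fin.natAdd 2 a)))) =
      fun a : Fin (p - 2 - i) => w (Fin.cast (show i + (2 + (p - 2 - i)) = p by omega)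
        (Fin.natAdd i (Fin.natAdd 2 a))) := by
    funext a
    rw [Function.update_of_ne]
    intro h
    have := congrArg Fin.val h
    simp at this
  rw [ea, eb]
  change _ * (phi (fun a : Fin 2 => w ⟨i + a, by omega⟩) _ * _) +
    _ * (phi (fun a : Fin 2 => Function.update w ⟨i, by omega⟩ 1 ⟨i + a, by omega⟩) _ * _) = 0
  rw [← mul_add, ← add_mul, key]
  simp

theorem phi_zero {p : ℕ} (hp : 3 ≤ p) (t : ⨂[k]^p (Fin 2 → k)) (ht : t ∈ W (Rex k) p)
    (n : ℕ) : ∀ (w : Fin p → Fin 2), (Finset.univ.filter (fun a => w a = 0)).card = n →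
      w ≠ 0 → phi w t = 0 := by
  induction n using Nat.strong_induction_on with
  | _ n ih =>
  intro w hn hw
  by_cases hd : ∃ i, ∃ hi : i + 1 < p, w ⟨i, by omega⟩ = 1 ∧ w ⟨i + 1, hi⟩ = 0
  · obtain ⟨i, hi, h0, h1⟩ := hd
    exact phi_descent t ht w i hi h0 h1
  by_cases ha : ∃ i, ∃ hi : i + 1 < p, w ⟨i, by omega⟩ = 0 ∧ w ⟨i + 1, hi⟩ = 1
  · obtain ⟨i, hi, h0, h1⟩ := ha
    have h := phi_ascent t ht w i hi h0 h1
    rw [ih _ _ (Function.update w ⟨i, by omega⟩ 1) rfl, add_zero] at h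
    · exact h
    · intro h
      have := congrFun h ⟨i, by omega⟩
      simp at this
    · rw [← hn]
      apply Finset.card_lt_card
      rw [Finset.ssubset_iff_of_subset]
      · exact ⟨⟨i, by omega⟩, by simp [h0], by simp⟩
      · intro a
        simp only [Finset.mem_filter, Finset.mem_univ, true_and, Function.update_apply]
        split_ifs <;> simp
  · have hc : ∀ i (hi : i < p), w ⟨i, hi⟩ = w ⟨0, by omega⟩ := by
      intro i
      induction i with
      | zero => intro _; rfl
      | succ i ih =>
        intro hi
        rw [← ih (by omega)]
        push Not at hd ha
        have h1 := hd i hi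
        have h2 := ha i hi
        generalize w ⟨i, by omega⟩ = A at *
        generalize w ⟨i + 1, by omega⟩ = B at *
        fin_cases A <;> fin_cases B <;> simp_all
    have h1 : ∀ a, w a = 1 := by
      intro a
      by_contra h
      apply hw
      funext b
      rw [hc b b.2, ← hc a a.2]
      change w a = 0
      generalize w a = A at *
      fin_cases A <;> simp_all
    have h := phi_ascent t ht (Function.update w ⟨1, by omega⟩ 0) 1 (by omega) (by simp)
      (by simp [Function.update_apply, h1])
    rw [phi_descent t ht (Function.update w ⟨1, by omega⟩ 0) 0 (by omega)
      (by simp [Function.update_apply, h1]) (by simp), zero_add, Function.update_idem,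
      Function.update_eq_self_iff.2 (h1 _).symm] at h
    exact h

theorem expand {p : ℕ} (t : ⨂[k]^p (Fin 2 → k)) :
    t = ∑ w : Fin p → Fin 2, phi w t •
      PiTensorProduct.tprod k (fun i => (Pi.single (w i) 1 : Fin 2 → k)) := by
  have : (LinearMap.id : (⨂[k]^p (Fin 2 → k)) →ₗ[k] _) = ∑ w : Fin p → Fin 2,
      (phi w).smulRight
        (PiTensorProduct.tprod k (fun i => (Pi.single (w i) 1 : Fin 2 → k))) := by
    apply PiTensorProduct.ext
    apply MultilinearMap.ext
    intro v
    simp only [LinearMap.compMultilinearMap_apply, LinearMap.id_apply, LinearMap.sum_apply,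
      LinearMap.smulRight_apply, phi_tprod]
    have hv : v = fun i => ∑ a : Fin 2, v i a • (Pi.single a 1 : Fin 2 → k) := by
      funext i
      exact pi_eq_sum_univ' (v i)
    conv_lhs => rw [hv, MultilinearMap.map_sum]
    simp only [MultilinearMap.map_smul_univ]
  have h := congrArg (fun f => f t) this
  simpa using h

end Helpers

section Example

variable (k : Type*) [Field k] [CharZero k]

theorem W_example_eq_span_xpow (p : ℕ) (hp : 3 ≤ p) :
    W (Rex k) p = Submodule.span k {PiTensorProduct.tprod k (fun _ : Fin p => xg k)} := by
  apply le_antisymm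
  · intro t ht
    rw [expand t, Finset.sum_eq_single 0]
    · exact Submodule.smul_mem _ _ (Submodule.mem_span_singleton_self _)
    · intro w _ hw
      rw [phi_zero hp t ht _ w rfl hw, zero_smul]
    · simp
  · rw [Submodule.span_singleton_le_iff_mem]
    simp only [W, Submodule.mem_iInf]
    intro i j h
    have h' : i + (2 + j) = p := by omega
    subst h'
    refine ⟨tpMul k _ i (2 + j) (PiTensorProduct.tprod k (fun _ => xg k) ⊗ₜ
      tpMul k _ 2 j (PiTensorProduct.tprod k ![xg k, xg k] ⊗ₜ
        PiTensorProduct.tprod k (fun _ => xg k))), ?_, ?_⟩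
    · refine ⟨_, Submodule.apply_mem_map₂ _ trivial ⟨_, Submodule.apply_mem_map₂ _
        ⟨xg k ⊗ₜ xg k, Submodule.subset_span (by simp), e2_symm_tmul _ _⟩ trivial, rfl⟩, rfl⟩
    · rw [tpMul_tprod, tpMul_tprod]
      erw [PiTensorProduct.reindex_tprod]
      congr 1
      funext s
      refine Fin.addCases (fun s => ?_) (fun s => ?_) s
      · simp
      · refine Fin.addCases (fun s => ?_) (fun s => ?_) s
        · fin_cases s <;> simp
        · simp

end Example
end
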